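/- Let a and b be natural numbers and N = 2(a+b)+7. If gcd(b+1, N) = 1 and gcd(2a+b+5, N) = 1, then the kernel of the circulant matrix H_y over F_2 consists exactly of the zero vector and the all-ones vector: for every v : ZMod N → F_2 with H_y *ᵥ v = 0, either v = 0 or v i = 1 for all i. (Thus the quantum XYZ cyclic code C(a,b) has repetition code structure under pure Pauli Y noise.) -/

import Mathlib

open Matrix

instance (n : ℕ) : NeZero (2 * n + 7) := ⟨by omega⟩

/-- The circulant parity-check matrix `H_y` of the quantum XYZ cyclic code `C(a,b)`,
whose symbol is the indicator function of `{0, b+1, 2a+b+5, 2(a+b)+6} ⊆ ZMod (2(a+b)+7)`;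
it is the entrywise sum (mod 2) of `H_x` and `H_z`. -/
def Hy (a b : ℕ) : Matrix (ZMod (2 * (a + b) + 7)) (ZMod (2 * (a + b) + 7)) (ZMod 2) :=
  Matrix.circulant fun i =>
    if i ∈ ({((0 : ℕ) : ZMod (2 * (a + b) + 7)), ((b + 1 : ℕ) : ZMod (2 * (a + b) + 7)),
        ((2 * a + b + 5 : ℕ) : ZMod (2 * (a + b) + 7)),
        ((2 * (a + b) + 6 : ℕ) : ZMod (2 * (a + b) + 7))} : Finset (ZMod (2 * (a + b) + 7)))
    then 1 else 0

/-- A function on `ZMod n` that grows by `c` along a step `s` is affine along multiples of `s`. -/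
lemma apply_nat_mul_of_step {n : ℕ} {R : Type*} [Ring R] {f : ZMod n → R} {s : ZMod n} {c : R}
    (h : ∀ i, f i = f (i - s) + c) (k : ℕ) : f (k * s) = f 0 + k * c := by
  induction k with
  | zero => simp
  | succ k ih =>
    rw [h, show ((k + 1 : ℕ) : ZMod n) * s - s = k * s by push_cast; ring, ih]
    push_cast
    rw [add_mul, one_mul, add_assoc]

/-- A function on `ZMod n` invariant under translation by a unit is constant. -/
lemma eq_apply_zero_of_step {n : ℕ} [NeZero n] {R : Type*} [Ring R] {f : ZMod n → R} {s : ℕ}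
    (hs : s.Coprime n) (h : ∀ i, f i = f (i - s)) (i : ZMod n) : f i = f 0 := by
  have key := apply_nat_mul_of_step (f := f) (s := (s : ZMod n)) (c := 0) (by simpa using h)
     (i * (s : ZMod n)⁻¹).val
  rwa [ZMod.natCast_zmod_val, mul_assoc, mul_comm _ (s : ZMod n),
    ZMod.coe_mul_inv_eq_one s hs, mul_one, mul_zero, add_zero] at key

lemma circulant_indicator_mulVec {n R : Type*} [Fintype n] [DecidableEq n] [AddCommGroup n]
    [Semiring R] (S : Finset n) (v : n → R) (i : n) :
    (Matrix.circulant (fun j => if j ∈ S then (1 : R) else 0) *ᵥ v) i = ∑ j ∈ S, v (i - j) := by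
  rw [Matrix.mulVec, dotProduct, ← (Equiv.subLeft i).sum_comp]
  simp [Matrix.circulant_apply]

lemma Hy_mulVec_apply (a b : ℕ) (v : ZMod (2 * (a + b) + 7) → ZMod 2)
    (i : ZMod (2 * (a + b) + 7)) :
    (Hy a b *ᵥ v) i = v i + v (i - (b + 1 : ℕ)) + v (i - (2 * a + b + 5 : ℕ)) +
      v (i - (2 * a + b + 5 : ℕ) - (b + 1 : ℕ)) := by
  have hne : ∀ x y : ℕ, x < 2 * (a + b) + 7 → y < 2 * (a + b) + 7 → x ≠ y →
      (x : ZMod (2 * (a + b) + 7)) ≠ y := fun x y hx hy hxy h =>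
    hxy (by rwa [ZMod.natCast_eq_natCast_iff', Nat.mod_eq_of_lt hx, Nat.mod_eq_of_lt hy] at h)
  rw [Hy, circulant_indicator_mulVec, Finset.sum_insert, Finset.sum_insert, Finset.sum_insert,
    Finset.sum_singleton, sub_sub, ← Nat.cast_add,
    show 2 * a + b + 5 + (b + 1) = 2 * (a + b) + 6 by ring, Nat.cast_zero, sub_zero]
  · ring
  all_goals
    simp only [Finset.mem_insert, Finset.mem_singleton, not_or]
    repeat' apply And.intro
    all_goals apply hne <;> omega

/-- If `gcd(b+1, N) = 1` and `gcd(2a+b+5, N) = 1` (`N = 2(a+b)+7`), the kernel of `H_y`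
over `F_2` consists exactly of the zero vector and the all-ones vector: the quantum XYZ
cyclic code `C(a,b)` has repetition code structure under pure Pauli `Y` noise. -/
theorem xyz_repetition_structure_pauliY (a b : ℕ)
    (h1 : Nat.gcd (b + 1) (2 * (a + b) + 7) = 1)
    (h2 : Nat.gcd (2 * a + b + 5) (2 * (a + b) + 7) = 1) :
    ∀ v : ZMod (2 * (a + b) + 7) → ZMod 2,
      Hy a b *ᵥ v = 0 → v = 0 ∨ ∀ i, v i = 1 := by
  intro v hv
  have hstep : ∀ i, v i + v (i - (b + 1 : ℕ)) = v 0 + v (0 - (b + 1 : ℕ)) :=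
    eq_apply_zero_of_step (f := fun i => v i + v (i - (b + 1 : ℕ))) h2 fun i => by
      have h := congrFun hv i
      rw [Hy_mulVec_apply, Pi.zero_apply, add_assoc] at h
      exact CharTwo.add_eq_zero.mp h
  have haff : ∀ i, v i = v (i - (b + 1 : ℕ)) + (v 0 + v (0 - (b + 1 : ℕ))) := fun i => by
    rw [← hstep i, add_comm (v i), CharTwo.add_cancel_left]
  have hodd : ((2 * (a + b) + 7 : ℕ) : ZMod 2) = 1 :=
    ZMod.natCast_eq_one_iff_odd.mpr ⟨a + b + 3, by ring⟩
  have hzero : v 0 + v (0 - (b + 1 : ℕ)) = 0 := by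
    have h := apply_nat_mul_of_step haff (2 * (a + b) + 7)
    rw [ZMod.natCast_self, zero_mul, hodd, one_mul] at h
    exact left_eq_add.mp h
  have hconst : ∀ i, v i = v 0 :=
    eq_apply_zero_of_step h1 fun i => by rw [haff i, hzero, add_zero]
  rcases (by decide : ∀ x : ZMod 2, x = 0 ∨ x = 1) (v 0) with h | h
  · exact .inl (funext fun i => (hconst i).trans h)
  · exact .inr fun i => (hconst i).trans h
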